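/- Let N be a nilpotent endomorphism of a finite dimensional vector space V over a field of characteristic zero. Then there exists a unique increasing filtration W(N) of V such that (a) N(W(N)_j) ⊆ W(N)_{j−2} for all j, and (b) N^ℓ : Gr^{W(N)}_ℓ → Gr^{W(N)}_{−ℓ} is an isomorphism for all ℓ ≥ 0. -/

import Mathlib

/-- `W` is the monodromy weight filtration of the nilpotent endomorphism `N` (centered at 0):
an increasing, finite, exhaustive filtration with (a) `N(W_j) ⊆ W_{j-2}` and (b)
`N^ℓ : Gr_ℓ → Gr_{-ℓ}` an isomorphism for all `ℓ ≥ 0` (surjectivity expressed as a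
`⊔`-equation, injectivity as a `⊓ ≤` inclusion). -/
def IsWeightFiltration {K V : Type*} [Field K] [AddCommGroup V] [Module K V]
    (N : Module.End K V) (W : ℤ → Submodule K V) : Prop :=
  Monotone W ∧ (∃ a, ∀ k ≤ a, W k = ⊥) ∧ (∃ b, ∀ k, b ≤ k → W k = ⊤) ∧
  (∀ j : ℤ, (W j).map N ≤ W (j - 2)) ∧
  (∀ ℓ : ℕ,
    (Submodule.map (N ^ ℓ) (W ℓ) ⊔ W (-ℓ - 1) = W (-ℓ)) ∧
    (W ℓ ⊓ Submodule.comap (N ^ ℓ) (W (-ℓ - 1)) ≤ W (ℓ - 1)))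

namespace IsWeightFiltration

variable {K V : Type*} [Field K] [AddCommGroup V] [Module K V] {N : Module.End K V}
  {W W' : ℤ → Submodule K V}

theorem apply_mem (hW : IsWeightFiltration N W) {j : ℤ} {v : V} (hv : v ∈ W j) :
    N v ∈ W (j - 2) :=
  hW.2.2.2.1 j (Submodule.mem_map_of_mem hv)

theorem pow_apply_mem (hW : IsWeightFiltration N W) {j : ℤ} {v : V} (hv : v ∈ W j) (k : ℕ) :
    (N ^ k) v ∈ W (j - 2 * k) := by
  induction k with
  | zero => simpa using hv
  | succ k ih =>
    rw [pow_succ', Module.End.mul_apply]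
    convert hW.apply_mem ih using 2
    push_cast
    ring

theorem ker_pow_le (hW : IsWeightFiltration N W) (l : ℕ) : (N ^ l).ker ≤ W (l - 1) := by
  intro v hv
  have descend : ∀ t : ℕ, v ∈ W (l - 1 + t) → v ∈ W (l - 1) := by
    intro t
    induction t with
    | zero => simp
    | succ t ih =>
      intro h
      refine ih ?_
      have e : (l : ℤ) - 1 + (t + 1 : ℕ) = (l + t : ℕ) := by push_cast; ring
      have e' : (l : ℤ) - 1 + t = (l + t : ℕ) - 1 := by push_cast; ring
      rw [e']
      refine (hW.2.2.2.2 (l + t)).2 ⟨e ▸ h, ?_⟩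
      have h0 : (N ^ (l + t)) v = 0 := by
        rw [add_comm, pow_add, Module.End.mul_apply, LinearMap.mem_ker.1 hv, map_zero]
      rw [SetLike.mem_coe, Submodule.mem_comap, h0]
      exact zero_mem _
  obtain ⟨b, hb⟩ := hW.2.2.1
  refine descend (b - (l - 1)).toNat ?_
  rw [hb _ (by lia)]
  trivial

theorem neg_eq_map (hW : IsWeightFiltration N W) (l : ℕ) :
    W (-l) = (W l).map (N ^ l) := by
  have descend : ∀ t l : ℕ, W (-(l + t)) = ⊥ → W (-l) ≤ (W l).map (N ^ l) := by
    intro t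
    induction t with
    | zero => intro l h; simp_all
    | succ t ih =>
      intro l h
      have h1 := ih (l + 1) (by rw [← h]; congr 1; push_cast; ring)
      rw [← (hW.2.2.2.2 l).1]
      refine sup_le le_rfl ?_
      have e : -(l : ℤ) - 1 = -(l + 1 : ℕ) := by push_cast; ring
      rw [e]
      refine h1.trans ?_
      rintro _ ⟨v, hv, rfl⟩
      rw [pow_succ, Module.End.mul_apply]
      exact Submodule.mem_map_of_mem (hW.1 (by push_cast; lia) (hW.apply_mem hv))
  refine le_antisymm ?_ (le_sup_left.trans (hW.2.2.2.2 l).1.le)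
  obtain ⟨a, ha⟩ := hW.2.1
  exact descend (-a).toNat l (ha _ (by lia))

theorem eq_comap (hW : IsWeightFiltration N W) (l : ℕ) :
    W l = (W (-(l + 2 : ℕ))).comap (N ^ (l + 1)) := by
  ext v
  rw [Submodule.mem_comap]
  constructor
  · intro hv
    convert hW.pow_apply_mem hv (l + 1) using 2
    push_cast
    ring
  · intro hv
    rw [hW.neg_eq_map] at hv
    obtain ⟨w, hw, hwv⟩ := hv
    have hk : v - N w ∈ (N ^ (l + 1)).ker := by
      rw [LinearMap.mem_ker, map_sub, ← hwv, ← Module.End.mul_apply, ← pow_succ, sub_self]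
    have h1 := hW.ker_pow_le (l + 1) hk
    have h2 := hW.apply_mem hw
    have e1 : ((l + 1 : ℕ) : ℤ) - 1 = l := by push_cast; ring
    have e2 : ((l + 2 : ℕ) : ℤ) - 2 = l := by push_cast; ring
    rw [e1] at h1
    rw [e2] at h2
    simpa using add_mem h1 h2

theorem unique (hW : IsWeightFiltration N W) (hW' : IsWeightFiltration N W') : W = W' := by
  obtain ⟨a, ha⟩ := hW.2.1
  obtain ⟨a', ha'⟩ := hW'.2.1
  have descend : ∀ t l : ℕ, -(l + 2 * t : ℤ) ≤ min a a' → W (-l) = W' (-l) := by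
    intro t
    induction t with
    | zero => intro l h; rw [ha _ (by lia), ha' _ (by lia)]
    | succ t ih =>
      intro l h
      rw [hW.neg_eq_map, hW'.neg_eq_map, hW.eq_comap, hW'.eq_comap,
        ih (l + 2) (by push_cast at h ⊢; lia)]
  have hneg (l : ℕ) : W (-l) = W' (-l) := descend (-(min a a')).toNat l (by lia)
  funext j
  obtain ⟨l, rfl | rfl⟩ := j.eq_nat_or_neg
  · rw [hW.eq_comap, hW'.eq_comap, hneg]
  · exact hneg l

end IsWeightFiltration

/-- The monodromy weight filtration of `N`: its `j`-th step is the sum of the subspaces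
`N ^ a (ker N ^ (a + b + 1)) = im N ^ a ∩ ker N ^ (b + 1)` with `b - a = j`. -/
def weightFiltration {K V : Type*} [Field K] [AddCommGroup V] [Module K V]
    (N : Module.End K V) (j : ℤ) : Submodule K V :=
  ⨆ (a : ℕ) (b : ℕ) (_ : (b : ℤ) - a = j), (N ^ (a + b + 1)).ker.map (N ^ a)

section weightFiltration

variable {K V : Type*} [Field K] [AddCommGroup V] [Module K V] (N : Module.End K V)

theorem map_ker_pow_le_weightFiltration {j : ℤ} (a b : ℕ) (h : (b : ℤ) - a = j) :
    (N ^ (a + b + 1)).ker.map (N ^ a) ≤ weightFiltration N j :=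
  le_iSup₂_of_le a b (le_iSup_of_le h le_rfl)

theorem weightFiltration_le_iff {j : ℤ} {S : Submodule K V} :
    weightFiltration N j ≤ S ↔
      ∀ a b : ℕ, (b : ℤ) - a = j → ∀ v, (N ^ (a + b + 1)) v = 0 → (N ^ a) v ∈ S := by
  simp only [weightFiltration, iSup_le_iff, Submodule.map_le_iff_le_comap]
  rfl

theorem pow_apply_mem_weightFiltration {j : ℤ} (a b : ℕ) (h : (b : ℤ) - a = j) {v : V}
    (hv : (N ^ (a + b + 1)) v = 0) : (N ^ a) v ∈ weightFiltration N j :=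
  map_ker_pow_le_weightFiltration N a b h (Submodule.mem_map_of_mem hv)

theorem weightFiltration_mono : Monotone (weightFiltration N) := by
  refine monotone_int_of_le_succ fun j => (weightFiltration_le_iff N).2 fun a b h v hv => ?_
  refine pow_apply_mem_weightFiltration N a (b + 1) (by push_cast; lia) ?_
  rw [← add_assoc, pow_succ', Module.End.mul_apply, hv, map_zero]

theorem map_weightFiltration_le (j : ℤ) :
    (weightFiltration N j).map N ≤ weightFiltration N (j - 2) := by
  rw [Submodule.map_le_iff_le_comap, weightFiltration_le_iff]
  intro a b h v hv
  rw [Submodule.mem_comap, ← Module.End.mul_apply, ← pow_succ']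
  cases b with
  | zero =>
    rw [add_zero] at hv
    rw [hv]
    exact zero_mem _
  | succ b =>
    refine pow_apply_mem_weightFiltration N (a + 1) b (by push_cast at h ⊢; lia) ?_
    rwa [show a + 1 + b + 1 = a + (b + 1) + 1 by ring]

theorem map_pow_weightFiltration (l : ℕ) :
    (weightFiltration N l).map (N ^ l) = weightFiltration N (-l) := by
  apply le_antisymm
  · rw [Submodule.map_le_iff_le_comap, weightFiltration_le_iff]
    intro a b h v hv
    obtain rfl : b = a + l := by lia
    rw [Submodule.mem_comap, ← Module.End.mul_apply, ← pow_add]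
    refine pow_apply_mem_weightFiltration N (l + a) a (by push_cast; lia) ?_
    rwa [show l + a + a + 1 = a + (a + l) + 1 by ring]
  · rw [weightFiltration_le_iff]
    intro a b h v hv
    obtain rfl : a = l + b := by lia
    rw [pow_add, Module.End.mul_apply]
    refine Submodule.mem_map_of_mem
      (pow_apply_mem_weightFiltration N b (b + l) (by push_cast; lia) ?_)
    rwa [show b + (b + l) + 1 = l + b + b + 1 by ring]

theorem ker_pow_le_weightFiltration (l : ℕ) : (N ^ (l + 1)).ker ≤ weightFiltration N l := by
  intro v hv
  have := pow_apply_mem_weightFiltration N (j := l) 0 l (by simp) (v := v) (by simpa using hv)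
  simpa using this

theorem comap_pow_weightFiltration_le (l : ℕ) :
    (weightFiltration N (-l - 1)).comap (N ^ l) ≤ weightFiltration N (l - 1) := by
  cases l with
  | zero => intro v hv; simpa using hv
  | succ l =>
    intro v hv
    have e : -((l + 1 : ℕ) : ℤ) - 1 = -(l + 2 : ℕ) := by push_cast; ring
    rw [Submodule.mem_comap, e, ← map_pow_weightFiltration] at hv
    obtain ⟨w, hw, hwv⟩ := hv
    have hk : v - N w ∈ (N ^ (l + 1)).ker := by
      rw [LinearMap.mem_ker, map_sub, ← hwv, ← Module.End.mul_apply, ← pow_succ, sub_self]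
    have h1 := ker_pow_le_weightFiltration N l hk
    have h2 := map_weightFiltration_le N _ (Submodule.mem_map_of_mem hw)
    have e1 : ((l + 1 : ℕ) : ℤ) - 1 = l := by push_cast; ring
    have e2 : ((l + 2 : ℕ) : ℤ) - 2 = l := by push_cast; ring
    rw [e2] at h2
    rw [e1]
    simpa using add_mem h1 h2

variable {N}

theorem isWeightFiltration_weightFiltration (hN : IsNilpotent N) :
    IsWeightFiltration N (weightFiltration N) := by
  obtain ⟨n, hn⟩ := hN
  refine ⟨weightFiltration_mono N, ⟨-n, fun k hk => ?_⟩, ⟨n, fun k hk => ?_⟩,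
    map_weightFiltration_le N, fun l => ⟨?_, ?_⟩⟩
  · rw [eq_bot_iff, weightFiltration_le_iff]
    intro a b h v _
    rw [pow_eq_zero_of_le (by lia : n ≤ a) hn]
    simp
  · obtain ⟨l, rfl⟩ : ∃ l : ℕ, k = l := ⟨k.toNat, by lia⟩
    refine eq_top_iff.2 (le_trans ?_ (ker_pow_le_weightFiltration N l))
    rw [pow_eq_zero_of_le (by lia : n ≤ l + 1) hn, LinearMap.ker_zero]
  · rw [map_pow_weightFiltration]
    exact sup_eq_left.2 (weightFiltration_mono N (by lia))
  · exact inf_le_right.trans (comap_pow_weightFiltration_le N l)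

end weightFiltration

/-- Let `N` be a nilpotent endomorphism of a finite dimensional vector space
over a field of characteristic zero.  Then there exists a unique increasing filtration
`W(N)` such that (a) `N(W_j) ⊆ W_{j-2}` and (b) `N^ℓ : Gr_ℓ → Gr_{-ℓ}` is an isomorphism
for all `ℓ ≥ 0`. -/
theorem stmt19 (K V : Type*) [Field K] [CharZero K] [AddCommGroup V] [Module K V]
    [FiniteDimensional K V]
    (N : Module.End K V) (hN : IsNilpotent N) :
    ∃! W : ℤ → Submodule K V, IsWeightFiltration N W := by
  exact ⟨weightFiltration N, isWeightFiltration_weightFiltration hN,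
    fun _ hW => hW.unique (isWeightFiltration_weightFiltration hN)⟩
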